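/- arXiv:1909.09002 — 5 statements merged into one kernel-verified Lean document; each statement's English description precedes it below -/
import Mathlib

section
/- Let 0 < α ≤ 1/2, W > 0, ℓ ≥ 0, and 0 ≤ D < W/(1−α) be reals, and let r be a random variable distributed uniformly on the interval [0, W]. Then the probability that r lies in the open interval ( D − αW/(1−α) , (1+α²)(D+ℓ) ) is at most (5/4)·ℓ/W + α·(1+4α). -/
open MeasureTheory

/-- Probabilistic core of Lemma 3.5. For `r` uniform on `[0, W]`
(measure `λ(· ∩ [0,W]) / W`), the probability that `r` falls in the open interval
`(D - α W / (1-α), (1+α²)(D+ℓ))` is at most `(5/4) ℓ / W + α (1 + 4 α)`. -/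
theorem stmt_3
    (α W ℓ D : ℝ) (hα0 : 0 < α) (hα : α ≤ 1 / 2) (hW : 0 < W) (hℓ : 0 ≤ ℓ)
    (hD0 : 0 ≤ D) (hD : D < W / (1 - α))
    (μ : Measure ℝ)
    (hμ : ∀ A : Set ℝ, MeasurableSet A →
        μ A = volume (A ∩ Set.Icc 0 W) / ENNReal.ofReal W) :
    μ (Set.Ioo (D - α * W / (1 - α)) ((1 + α ^ 2) * (D + ℓ)))
      ≤ ENNReal.ofReal ((5 / 4) * ℓ / W + α * (1 + 4 * α)) := by
  have hα1 : 0 < 1 - α := by linarith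
  rw [hμ _ measurableSet_Ioo]
  calc volume (Set.Ioo (D - α * W / (1 - α)) ((1 + α ^ 2) * (D + ℓ)) ∩ Set.Icc 0 W)
        / ENNReal.ofReal W
      ≤ volume (Set.Ioo (D - α * W / (1 - α)) ((1 + α ^ 2) * (D + ℓ))) / ENNReal.ofReal W := by
        gcongr
        exact Set.inter_subset_left
    _ = ENNReal.ofReal (((1 + α ^ 2) * (D + ℓ) - (D - α * W / (1 - α))) / W) := by
        rw [Real.volume_Ioo, ENNReal.ofReal_div_of_pos hW]
    _ ≤ ENNReal.ofReal ((5 / 4) * ℓ / W + α * (1 + 4 * α)) := by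
        apply ENNReal.ofReal_le_ofReal
        have hα_sq : α ^ 2 ≤ 1 / 4 := by nlinarith
        have hℓ_le : α ^ 2 * ℓ ≤ 1 / 4 * ℓ := by gcongr
        have hD_le : α ^ 2 * D ≤ α ^ 2 * (W / (1 - α)) := by gcongr
        have hcoef : α * (1 + α) / (1 - α) ≤ α * (1 + 4 * α) := by
          rw [div_le_iff₀ hα1]
          nlinarith [mul_nonneg (sq_nonneg α) (by linarith : 0 ≤ 1 - 2 * α)]
        have hscaled := mul_le_mul_of_nonneg_right hcoef hW.le
        have hsum : α ^ 2 * (W / (1 - α)) + α * W / (1 - α) = α * (1 + α) / (1 - α) * W := by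
          ring
        rw [div_le_iff₀ hW, add_mul (5 / 4 * ℓ / W), div_mul_cancel₀ _ hW.ne']
        linarith
end

section
/- Let 0 < α ≤ 1/2, ρ > 0, and 0 < ℓ ≤ ρ be reals. Let i_e be the largest integer i ≥ 1 with ℓ ≤ α^{i−1}·ρ (this exists and is finite since ℓ ≤ ρ and α < 1). Let q_1, …, q_{i_e} be reals with 0 ≤ q_i and q_i ≤ (5/4)·ℓ/(α^{i−1}ρ) + α·(1+4α) for each 1 ≤ i ≤ i_e. Then ∏_{i=1}^{i_e} q_i ≤ 25 · (ℓ/ρ) · (1+6α)^{i_e}. -/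
/-- Deterministic product-bound core of Lemma 3.6. With `i_e` the
largest index `i ≥ 1` such that `ℓ ≤ α^{i-1} ρ`, and per-iteration bounds
`0 ≤ q i ≤ (5/4) ℓ / (α^{i-1} ρ) + α (1 + 4α)`, the product of the `q i` over
`i = 1, …, i_e` is at most `25 (ℓ/ρ) (1+6α)^{i_e}`. -/
theorem stmt_4
    (α ρ ℓ : ℝ) (hα0 : 0 < α) (hα : α ≤ 1 / 2) (hρ : 0 < ρ) (hℓ0 : 0 < ℓ) (hℓρ : ℓ ≤ ρ)
    (i_e : ℕ) (hie1 : 1 ≤ i_e) (hie : ℓ ≤ α ^ (i_e - 1) * ρ)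
    (hmax : ∀ i : ℕ, 1 ≤ i → ℓ ≤ α ^ (i - 1) * ρ → i ≤ i_e)
    (q : ℕ → ℝ)
    (hq : ∀ i ∈ Finset.Icc 1 i_e,
        0 ≤ q i ∧ q i ≤ (5 / 4) * ℓ / (α ^ (i - 1) * ρ) + α * (1 + 4 * α)) :
    ∏ i ∈ Finset.Icc 1 i_e, q i ≤ 25 * (ℓ / ρ) * (1 + 6 * α) ^ i_e := by
  have hlt : α ^ i_e * ρ < ℓ := by
    by_contra! h
    have := hmax (i_e + 1) (by omega) (by simpa using h)
    omega
  have hlast : q i_e ≤ ℓ / (α ^ (i_e - 1) * ρ) * (9 / 4 * (1 + 6 * α)) := by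
    have hαt : α ≤ ℓ / (α ^ (i_e - 1) * ρ) := by
      rw [le_div_iff₀ (by positivity)]
      calc α * (α ^ (i_e - 1) * ρ) = α ^ (i_e - 1 + 1) * ρ := by ring
        _ = α ^ i_e * ρ := by rw [Nat.sub_add_cancel hie1]
        _ ≤ ℓ := hlt.le
    have h := (hq i_e (by simp [hie1])).2
    rw [mul_div_assoc] at h
    nlinarith [mul_le_mul_of_nonneg_right hαt (by positivity : 0 ≤ 1 + 4 * α),
      mul_pos hα0 (hα0.trans_le hαt)]
  obtain ⟨n, rfl⟩ : ∃ n, i_e = n + 1 := ⟨i_e - 1, by omega⟩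
  rcases n with _ | m
  · have : 0 < ℓ / ρ := by positivity
    simp only [zero_add, Nat.sub_self, pow_zero, one_mul] at hlast
    simp only [zero_add, Finset.Icc_self, Finset.prod_singleton, pow_one]
    nlinarith [mul_pos this hα0]
  have hie' : ℓ ≤ α ^ (m + 1) * ρ := hie
  have hpen : q (m + 1) ≤ α * (9 / 4 * (1 + 6 * α)) := by
    have h := (hq (m + 1) (by simp)).2
    have ht : ℓ / (α ^ (m + 1 - 1) * ρ) ≤ α := by
      rw [div_le_iff₀ (by positivity)]
      calc ℓ ≤ α ^ (m + 1) * ρ := hie'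
        _ = α * (α ^ (m + 1 - 1) * ρ) := by rw [Nat.add_sub_cancel]; ring
    rw [mul_div_assoc] at h
    nlinarith [mul_pos hα0 hα0]
  have hinit : ∏ i ∈ Finset.Icc 1 m, q i ≤ (α * (1 + 6 * α)) ^ m := by
    calc ∏ i ∈ Finset.Icc 1 m, q i ≤ ∏ _i ∈ Finset.Icc 1 m, α * (1 + 6 * α) := by
          refine Finset.prod_le_prod (fun i hi => ?_) (fun i hi => ?_) <;>
            rw [Finset.mem_Icc] at hi
          · exact (hq i (by rw [Finset.mem_Icc]; omega)).1
          · have h := (hq i (by rw [Finset.mem_Icc]; omega)).2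
            have ht : ℓ / (α ^ (i - 1) * ρ) ≤ α ^ 2 := by
              rw [div_le_iff₀ (by positivity)]
              calc ℓ ≤ α ^ (m + 1) * ρ := hie'
                _ ≤ α ^ (2 + (i - 1)) * ρ := by
                  refine mul_le_mul_of_nonneg_right ?_ hρ.le
                  exact pow_le_pow_of_le_one hα0.le (by linarith) (by omega)
                _ = α ^ 2 * (α ^ (i - 1) * ρ) := by rw [pow_add]; ring
            rw [mul_div_assoc] at h
            nlinarith [mul_pos hα0 hα0]
      _ = (α * (1 + 6 * α)) ^ m := by simp
  rw [Finset.prod_Icc_succ_top (by omega), Finset.prod_Icc_succ_top (by omega)]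
  have hq1 := (hq (m + 1) (by simp)).1
  have hq2 := (hq (m + 1 + 1) (by simp)).1
  calc (∏ i ∈ Finset.Icc 1 m, q i) * q (m + 1) * q (m + 1 + 1)
      ≤ (α * (1 + 6 * α)) ^ m * (α * (9 / 4 * (1 + 6 * α))) *
          (ℓ / (α ^ (m + 1) * ρ) * (9 / 4 * (1 + 6 * α))) :=
        mul_le_mul (mul_le_mul hinit hpen hq1 (by positivity)) hlast hq2 (by positivity)
    _ = 81 / 16 * (ℓ / ρ) * (1 + 6 * α) ^ (m + 1 + 1) := by
        rw [mul_pow]; field_simp; ring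
    _ ≤ 25 * (ℓ / ρ) * (1 + 6 * α) ^ (m + 1 + 1) := by
        gcongr; norm_num
end

section
/- Let C ≥ 1 be a real. For all reals n ≥ 16, all reals α with 0 < α ≤ min(1/2, ln(ln n)/ln n), and all reals 0 < ℓ ≤ ρ with ρ ≤ n^C·ℓ, let i_e be the largest integer i ≥ 1 with ℓ ≤ α^{i−1}·ρ. Then (1+6α)^{i_e} ≤ exp(3 + 12C). Consequently, if additionally q_1, …, q_{i_e} are reals with 0 ≤ q_i ≤ (5/4)·ℓ/(α^{i−1}ρ) + α·(1+4α) for each i, then ∏_{i=1}^{i_e} q_i ≤ 25·exp(3+12C)·(ℓ/ρ). -/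
/-- If `α ≤ log (log n) / log n`, then `α * log n` is at most twice `log (1 / α)`. -/
theorem mul_log_le_two_mul_neg_log {n α : ℝ} (hn : 1 < n) (hα0 : 0 < α)
    (hα : α ≤ Real.log (Real.log n) / Real.log n) :
    α * Real.log n ≤ 2 * -Real.log α := by
  have hM : 0 < Real.log n := Real.log_pos hn
  have hαM : α * Real.log n ≤ Real.log (Real.log n) := (le_div_iff₀ hM).mp hα
  have hL : 0 < Real.log (Real.log n) := (mul_pos hα0 hM).trans_le hαM
  have h1 : Real.log α ≤ Real.log (Real.log (Real.log n)) - Real.log (Real.log n) := by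
    rw [← Real.log_div hL.ne' hM.ne']
    exact Real.log_le_log hα0 hα
  have h2 := Real.log_le_sub_one_of_pos (half_pos hL)
  rw [Real.log_div hL.ne' two_ne_zero] at h2
  have h3 := Real.log_le_sub_one_of_pos (zero_lt_two (α := ℝ))
  linarith

/-- A geometric scale `α ^ m * ρ` that is still at least `ℓ` satisfies `α * m ≤ 2 * C`. -/
theorem mul_natCast_le_of_le_pow_mul {C n α ℓ ρ : ℝ} {m : ℕ} (hn : 1 < n) (hα0 : 0 < α)
    (hα : α ≤ Real.log (Real.log n) / Real.log n) (hℓ : 0 < ℓ)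
    (hρn : ρ ≤ n ^ C * ℓ) (hm : ℓ ≤ α ^ m * ρ) : α * m ≤ 2 * C := by
  have hM : 0 < Real.log n := Real.log_pos hn
  have hn0 : 0 < n := zero_lt_one.trans hn
  have h1 : 1 ≤ α ^ m * n ^ C := by
    refine le_of_mul_le_mul_right ?_ hℓ
    calc 1 * ℓ ≤ α ^ m * ρ := by rwa [one_mul]
      _ ≤ α ^ m * (n ^ C * ℓ) := by gcongr
      _ = α ^ m * n ^ C * ℓ := by ring
  have h2 := Real.log_nonneg h1
  rw [Real.log_mul (by positivity) (by positivity), Real.log_pow, Real.log_rpow hn0] at h2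
  have h3 := mul_le_mul_of_nonneg_left (mul_log_le_two_mul_neg_log hn hα0 hα)
    (Nat.cast_nonneg (α := ℝ) m)
  refine le_of_mul_le_mul_right ?_ hM
  linarith

theorem one_add_six_mul_pow_le_exp {C n α ℓ ρ : ℝ} {m : ℕ} (hn : 1 < n) (hα0 : 0 < α)
    (hα2 : α ≤ 1 / 2) (hα : α ≤ Real.log (Real.log n) / Real.log n) (hℓ : 0 < ℓ)
    (hρn : ρ ≤ n ^ C * ℓ) (hm : ℓ ≤ α ^ m * ρ) :
    (1 + 6 * α) ^ (m + 1) ≤ Real.exp (3 + 12 * C) := by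
  have h := mul_natCast_le_of_le_pow_mul hn hα0 hα hℓ hρn hm
  calc (1 + 6 * α) ^ (m + 1) ≤ Real.exp (6 * α) ^ (m + 1) := by
        gcongr
        linarith [Real.add_one_le_exp (6 * α)]
    _ = Real.exp ((m + 1 : ℕ) * (6 * α)) := (Real.exp_nat_mul _ _).symm
    _ ≤ Real.exp (3 + 12 * C) := by
        apply Real.exp_le_exp.mpr
        push_cast
        linarith

/-- The product bound, with the factors listed from the smallest scale upwards. -/
theorem prod_range_succ_le_of_le_geometric {α x : ℝ} (hα0 : 0 < α) (hα2 : α ≤ 1 / 2)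
    (hαx : α ≤ x) (hx1 : x ≤ 1) (m : ℕ) (p : ℕ → ℝ)
    (hp : ∀ j ≤ m, 0 ≤ p j ∧ p j ≤ 5 / 4 * x * α ^ j + α * (1 + 4 * α)) :
    ∏ j ∈ Finset.range (m + 1), p j ≤ 25 * (1 + 6 * α) ^ (m + 1) * (x * α ^ m) := by
  have hx0 : 0 < x := hα0.trans_le hαx
  have h0 : p 0 ≤ 17 / 4 * x := by
    have := (hp 0 (Nat.zero_le _)).2
    rw [pow_zero] at this
    nlinarith
  rcases m with _ | s
  · simp only [zero_add, Finset.prod_range_one, pow_one, pow_zero, mul_one]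
    nlinarith
  have h1 : p 1 ≤ 17 / 4 * α := by
    have := (hp 1 (by omega)).2
    rw [pow_one] at this
    nlinarith
  have h2 : ∏ j ∈ Finset.range s, p (j + 2) ≤ (α * (1 + 6 * α)) ^ s := by
    calc ∏ j ∈ Finset.range s, p (j + 2)
        ≤ ∏ _j ∈ Finset.range s, α * (1 + 6 * α) := by
          refine Finset.prod_le_prod (fun j hj => ?_) (fun j hj => ?_)
          · exact (hp _ (by have := Finset.mem_range.mp hj; omega)).1
          · have hj' := (hp (j + 2) (by have := Finset.mem_range.mp hj; omega)).2
            have hpow : α ^ (j + 2) ≤ α ^ 2 :=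
              pow_le_pow_of_le_one hα0.le (by linarith) (by omega)
            have : x * α ^ (j + 2) ≤ 1 * α ^ 2 := by gcongr
            nlinarith [sq_nonneg α]
      _ = (α * (1 + 6 * α)) ^ s := by simp
  rw [Finset.prod_range_succ', Finset.prod_range_succ']
  have hp0 := (hp 0 (by omega)).1
  have hp1 := (hp 1 (by omega)).1
  calc (∏ j ∈ Finset.range s, p (j + 2)) * p 1 * p 0
      ≤ (α * (1 + 6 * α)) ^ s * (17 / 4 * α) * (17 / 4 * x) := by gcongr
    _ = 289 / 16 * (1 + 6 * α) ^ s * (x * α ^ (s + 1)) := by rw [mul_pow]; ring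
    _ ≤ 25 * (1 + 6 * α) ^ (s + 1 + 1) * (x * α ^ (s + 1)) := by
        gcongr
        · norm_num
        · linarith
        · omega

/-- Lemma 3.6 in explicit abstract form. If `α ≤ min(1/2, ln ln n / ln n)`
and `ρ ≤ n^C ℓ`, then with `i_e` the largest index `i ≥ 1` such that `ℓ ≤ α^{i-1} ρ`,
we have `(1+6α)^{i_e} ≤ exp(3 + 12 C)`; consequently the product of per-iteration
bounds `q i` is at most `25 exp(3 + 12 C) (ℓ/ρ)`. -/
theorem stmt_5
    (C : ℝ) (hC : 1 ≤ C) (n : ℝ) (hn : 16 ≤ n)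
    (α : ℝ) (hα0 : 0 < α) (hα : α ≤ min (1 / 2) (Real.log (Real.log n) / Real.log n))
    (ℓ ρ : ℝ) (hℓ0 : 0 < ℓ) (hℓρ : ℓ ≤ ρ) (hρn : ρ ≤ n ^ C * ℓ)
    (i_e : ℕ) (hie1 : 1 ≤ i_e) (hie : ℓ ≤ α ^ (i_e - 1) * ρ)
    (hmax : ∀ i : ℕ, 1 ≤ i → ℓ ≤ α ^ (i - 1) * ρ → i ≤ i_e) :
    (1 + 6 * α) ^ i_e ≤ Real.exp (3 + 12 * C) ∧
    (∀ q : ℕ → ℝ,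
      (∀ i ∈ Finset.Icc 1 i_e,
          0 ≤ q i ∧ q i ≤ (5 / 4) * ℓ / (α ^ (i - 1) * ρ) + α * (1 + 4 * α)) →
      ∏ i ∈ Finset.Icc 1 i_e, q i ≤ 25 * Real.exp (3 + 12 * C) * (ℓ / ρ)) := by
  obtain ⟨m, rfl⟩ : ∃ m, i_e = m + 1 := ⟨i_e - 1, by omega⟩
  rw [Nat.add_sub_cancel] at hie
  have hα2 : α ≤ 1 / 2 := hα.trans (min_le_left _ _)
  have hexp : (1 + 6 * α) ^ (m + 1) ≤ Real.exp (3 + 12 * C) :=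
    one_add_six_mul_pow_le_exp (by linarith) hα0 hα2 (hα.trans (min_le_right _ _)) hℓ0 hρn hie
  refine ⟨hexp, fun q hq => ?_⟩
  have hρ0 : 0 < ρ := hℓ0.trans_le hℓρ
  have hd : 0 < α ^ m * ρ := by positivity
  have hlt : α ^ (m + 1) * ρ < ℓ := by
    by_contra! h
    have := hmax (m + 2) (by omega) h
    omega
  have hαx : α ≤ ℓ / (α ^ m * ρ) := by
    rw [le_div_iff₀ hd]
    calc α * (α ^ m * ρ) = α ^ (m + 1) * ρ := by ring
      _ ≤ ℓ := hlt.le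
  have hprod := prod_range_succ_le_of_le_geometric hα0 hα2 hαx ((div_le_one hd).mpr hie) m
    (fun j => q (m - j + 1)) (fun j hj => by
      have h := hq (m - j + 1) (Finset.mem_Icc.mpr ⟨by omega, by omega⟩)
      rw [Nat.add_sub_cancel] at h
      refine ⟨h.1, h.2.trans_eq ?_⟩
      have hpow : α ^ m = α ^ (m - j) * α ^ j := by rw [← pow_add, Nat.sub_add_cancel hj]
      rw [hpow]
      field_simp)
  have hre : ∏ i ∈ Finset.Icc 1 (m + 1), q i = ∏ j ∈ Finset.range (m + 1), q (m - j + 1) := by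
    rw [← Finset.prod_range_reflect]
    rw [Finset.range_eq_Ico, ← Finset.Ico_succ_right_eq_Icc, Nat.succ_eq_succ,
      Finset.prod_Ico_eq_prod_range, ← Finset.range_eq_Ico]
    refine Finset.prod_congr (by simp) fun j hj => ?_
    have := Finset.mem_range.mp hj
    congr 1
    simp at this
    omega
  rw [hre]
  calc ∏ j ∈ Finset.range (m + 1), q (m - j + 1)
      ≤ 25 * (1 + 6 * α) ^ (m + 1) * (ℓ / (α ^ m * ρ) * α ^ m) := hprod
    _ = 25 * (1 + 6 * α) ^ (m + 1) * (ℓ / ρ) := by field_simp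
    _ ≤ 25 * Real.exp (3 + 12 * C) * (ℓ / ρ) := by gcongr
end

section
/- Let 0 < p < 1, C ≥ 0, L ≥ 0, D > 0 be reals, let k ≥ 1 be an integer, and set d_i := D·2^{−i} for each integer i. Suppose ℓ > 0 is a real and i_e is an integer with 1 ≤ i_e ≤ k and d_{i_e} ≤ ℓ < 2·d_{i_e}. Let P_1, …, P_k be reals in [0,1] with Σ_{i=1}^{k} P_i ≤ 1 and P_i ≤ C·ℓ·L/d_i for each 1 ≤ i ≤ k. Then Σ_{i=1}^{k} P_i · (d_i/ℓ)^p ≤ 1 + 2·C·L/(1 − 2^{p−1}). -/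
/-- The reflected partial sums of a geometric series with ratio `r ∈ [0, 1)` are at most
`1 / (1 - r)`. -/
theorem sum_range_pow_reflect_le {r : ℝ} (hr0 : 0 ≤ r) (hr1 : r < 1) (n : ℕ) :
    ∑ i ∈ Finset.range n, r ^ (n - 1 - i) ≤ 1 / (1 - r) := by
  rw [Finset.sum_range_reflect (fun j => r ^ j) n, one_div, ← tsum_geometric_of_lt_one hr0 hr1]
  exact (summable_geometric_of_lt_one hr0 hr1).sum_le_tsum _ fun _ _ => pow_nonneg hr0 _

/-- Quantitative core of Lemma 5.9 (the `p`-stretch bound). With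
halving diameter bounds `d i = D / 2^i`, an edge of length `ℓ` with
`d i_e ≤ ℓ < 2 d i_e`, and per-level decoupling probabilities
`P i ≤ C ℓ L / d i` summing to at most `1`, the expected `p`-stretch
`∑_{i=1}^k P i (d i / ℓ)^p` is at most `1 + 2 C L / (1 - 2^{p-1})`. -/
theorem stmt_7
    (p C L D : ℝ) (hp0 : 0 < p) (hp1 : p < 1) (hC : 0 ≤ C) (hL : 0 ≤ L) (hD : 0 < D)
    (k : ℕ) (hk : 1 ≤ k)
    (d : ℕ → ℝ) (hd : ∀ i, d i = D / 2 ^ i)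
    (ℓ : ℝ) (hℓ : 0 < ℓ)
    (i_e : ℕ) (hie1 : 1 ≤ i_e) (hiek : i_e ≤ k)
    (hℓlo : d i_e ≤ ℓ) (hℓhi : ℓ < 2 * d i_e)
    (P : ℕ → ℝ) (hP01 : ∀ i ∈ Finset.Icc 1 k, 0 ≤ P i ∧ P i ≤ 1)
    (hPsum : ∑ i ∈ Finset.Icc 1 k, P i ≤ 1)
    (hPd : ∀ i ∈ Finset.Icc 1 k, P i ≤ C * ℓ * L / d i) :
    ∑ i ∈ Finset.Icc 1 k, P i * (d i / ℓ) ^ p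
      ≤ 1 + 2 * C * L / (1 - (2 : ℝ) ^ (p - 1)) := by
  set r : ℝ := (2 : ℝ) ^ (p - 1) with hr
  have hr0 : 0 ≤ r := by positivity
  have hr1 : r < 1 := Real.rpow_lt_one_of_one_lt_of_neg one_lt_two (by linarith)
  have hdpos : ∀ i, 0 < d i := fun i => by rw [hd]; positivity
  have hterm : ∀ i ∈ Finset.Icc 1 k, P i * (d i / ℓ) ^ p
      ≤ P i + if i < i_e then C * L * r ^ (i_e - 1 - i) else 0 := by
    intro i hi
    have hx : 0 < d i / ℓ := div_pos (hdpos i) hℓ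
    split_ifs with h
    · obtain ⟨m, rfl⟩ : ∃ m, i_e = i + m + 1 := ⟨i_e - i - 1, by omega⟩
      have hm : i + m + 1 - 1 - i = m := by omega
      have hge : (2 : ℝ) ^ m ≤ d i / ℓ := by
        rw [le_div_iff₀ hℓ]
        have hdi : (2 : ℝ) ^ m * (2 * d (i + m + 1)) = d i := by
          rw [hd, hd, pow_succ, pow_add]
          field_simp
        rw [← hdi]
        gcongr
      have hpow : (d i / ℓ) ^ (p - 1) ≤ r ^ m := by
        calc (d i / ℓ) ^ (p - 1) ≤ ((2 : ℝ) ^ m) ^ (p - 1) :=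
              Real.rpow_le_rpow_of_nonpos (by positivity) hge (by linarith)
          _ = r ^ m := by
              rw [hr, ← Real.rpow_natCast, ← Real.rpow_natCast, ← Real.rpow_mul zero_le_two,
                ← Real.rpow_mul zero_le_two, mul_comm]
      rw [hm]
      calc P i * (d i / ℓ) ^ p ≤ C * ℓ * L / d i * (d i / ℓ) ^ p := by
            gcongr
            exact hPd i hi
        _ = C * L * (d i / ℓ) ^ (p - 1) := by
            have := (hdpos i).ne'
            rw [Real.rpow_sub_one hx.ne']
            field_simp
        _ ≤ C * L * r ^ m := by gcongr
        _ ≤ P i + C * L * r ^ m := le_add_of_nonneg_left (hP01 i hi).1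
    · have hle : d i / ℓ ≤ 1 := by
        rw [div_le_one hℓ]
        refine le_trans ?_ hℓlo
        rw [hd, hd]
        gcongr
        · exact one_le_two
        · omega
      rw [add_zero]
      exact mul_le_of_le_one_right (hP01 i hi).1 (Real.rpow_le_one hx.le hle hp0.le)
  have hgeom : ∑ i ∈ Finset.Icc 1 k, (if i < i_e then C * L * r ^ (i_e - 1 - i) else 0)
      ≤ C * L * (1 / (1 - r)) := by
    rw [← Finset.sum_filter]
    calc ∑ i ∈ Finset.Icc 1 k with i < i_e, C * L * r ^ (i_e - 1 - i)
        ≤ ∑ i ∈ Finset.range i_e, C * L * r ^ (i_e - 1 - i) :=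
          Finset.sum_le_sum_of_subset_of_nonneg
            (fun i hi => Finset.mem_range.2 (Finset.mem_filter.1 hi).2)
            fun _ _ _ => by positivity
      _ = C * L * ∑ i ∈ Finset.range i_e, r ^ (i_e - 1 - i) := by rw [Finset.mul_sum]
      _ ≤ C * L * (1 / (1 - r)) := by
          gcongr
          exact sum_range_pow_reflect_le hr0 hr1 i_e
  have hslack : 0 ≤ C * L * (1 / (1 - r)) :=
    mul_nonneg (mul_nonneg hC hL) (one_div_nonneg.2 (sub_nonneg.2 hr1.le))
  calc ∑ i ∈ Finset.Icc 1 k, P i * (d i / ℓ) ^ p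
      ≤ ∑ i ∈ Finset.Icc 1 k, (P i + if i < i_e then C * L * r ^ (i_e - 1 - i) else 0) :=
        Finset.sum_le_sum hterm
    _ ≤ 1 + C * L * (1 / (1 - r)) := by
        rw [Finset.sum_add_distrib]
        exact add_le_add hPsum hgeom
    _ ≤ 1 + 2 * (C * L * (1 / (1 - r))) := by linarith
    _ = 1 + 2 * C * L / (1 - r) := by ring
end

section
/- Let (X, d) be a pseudometric space, let S be a nonempty finite set of 'centers' in X, and let ℓ : S → ℝ. For u ∈ X define D(u) := min_{x ∈ S} ( ℓ(x) + d(x, u) ). Then for all points v, w ∈ X and all centers x_v, x₀ ∈ S: ( ℓ(x_v) + d(x_v, v) ) − D(v) ≥ ( ℓ(x_v) + d(x_v, w) ) − ( ℓ(x₀) + d(x₀, w) ) − 2·d(v, w). Consequently, if ε ≥ 0 and M ≥ 0 are reals such that ℓ(x_v) + d(x_v, v) ≤ (1+ε)·D(v) and D(v) ≤ M, if x₀ attains min_{x ∈ S}( ℓ(x) + d(x, w) ), if Γ > 0 is such that ( ℓ(x) + d(x, w) ) − ( ℓ(x₀) + d(x₀, w) ) ≥ Γ for every center x ≠ x₀,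 and if x_v ≠ x₀, then d(v, w) ≥ (Γ − ε·M)/2. -/
/-- Deterministic core of Lemma 4.1. With `D u = min_{x ∈ S} (ℓ x + d(x,u))`,
we have the subtractive inequality
`(ℓ x_v + d(x_v, v)) - D v ≥ (ℓ x_v + d(x_v, w)) - (ℓ x₀ + d(x₀, w)) - 2 d(v, w)`,
and consequently, if `ℓ x_v + d(x_v, v) ≤ (1+ε) D v`, `D v ≤ M`, `x₀` attains the
minimum at `w`, every other center is at least `Γ` worse at `w`, and `x_v ≠ x₀`,
then `d(v, w) ≥ (Γ - ε M) / 2`. -/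
theorem stmt_8
    {X : Type*} [PseudoMetricSpace X]
    (S : Finset X) (hS : S.Nonempty) (ℓ : X → ℝ)
    (D : X → ℝ) (hD : ∀ u : X, D u = S.inf' hS (fun x => ℓ x + dist x u)) :
    (∀ v w : X, ∀ x_v ∈ S, ∀ x₀ ∈ S,
        (ℓ x_v + dist x_v v) - D v
          ≥ (ℓ x_v + dist x_v w) - (ℓ x₀ + dist x₀ w) - 2 * dist v w) ∧
    (∀ v w : X, ∀ x_v ∈ S, ∀ x₀ ∈ S, ∀ ε M Γ : ℝ,
        0 ≤ ε → 0 ≤ M → 0 < Γ →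
        ℓ x_v + dist x_v v ≤ (1 + ε) * D v → D v ≤ M →
        ℓ x₀ + dist x₀ w = S.inf' hS (fun x => ℓ x + dist x w) →
        (∀ x ∈ S, x ≠ x₀ → (ℓ x + dist x w) - (ℓ x₀ + dist x₀ w) ≥ Γ) →
        x_v ≠ x₀ →
        dist v w ≥ (Γ - ε * M) / 2) := by
  have key : ∀ v w : X, ∀ x_v ∈ S, ∀ x₀ ∈ S,
      (ℓ x_v + dist x_v v) - D v
        ≥ (ℓ x_v + dist x_v w) - (ℓ x₀ + dist x₀ w) - 2 * dist v w := by
    intro v w x_v _ x₀ hx₀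
    have hDv : D v ≤ ℓ x₀ + dist x₀ v :=
      (hD v).trans_le (Finset.inf'_le (fun x => ℓ x + dist x v) hx₀)
    have h_v := dist_triangle x_v v w
    have h₀ := dist_triangle_right x₀ v w
    linarith
  refine ⟨key, ?_⟩
  intro v w x_v hx_v x₀ hx₀ ε M Γ hε _ _ happrox hDM _ hgap hne
  have hsub := key v w x_v hx_v x₀ hx₀
  have hΓ := hgap x_v hx_v hne
  have hεM := mul_le_mul_of_nonneg_left hDM hε
  linarith
end
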